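/- arXiv:2312.11016 — 3 statements merged into one kernel-verified Lean document; each statement's English description precedes it below -/
import Mathlib

section
/- For every ω > 0 and every smooth function f : ℝ → ℝ, one has the factorizations S*(S f) = L₋ f and S(S* f) = M₊ f pointwise on ℝ; consequently S(L₋ f) = M₊(S f). -/
open Real

/-- `a_ω = √(1 + 16ω/3)`. -/
noncomputable def aCoef (ω : ℝ) : ℝ := Real.sqrt (1 + 16 * ω / 3)

/-- The solitary wave profile `Q_ω(y) = √(4 / (1 + a_ω cosh 2y))`. -/
noncomputable def Q (ω : ℝ) (y : ℝ) : ℝ :=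
  Real.sqrt (4 / (1 + aCoef ω * Real.cosh (2 * y)))

/-- `L₋ f = -f'' + f - Q_ω² f - ω Q_ω⁴ f`. -/
noncomputable def Lm (ω : ℝ) (f : ℝ → ℝ) : ℝ → ℝ :=
  fun y => -(deriv (deriv f) y) + f y - (Q ω y) ^ 2 * f y - ω * (Q ω y) ^ 4 * f y

/-- `M₊ f = -f'' + f + (ω/3) Q_ω⁴ f`. -/
noncomputable def Mp (ω : ℝ) (f : ℝ → ℝ) : ℝ → ℝ :=
  fun y => -(deriv (deriv f) y) + f y + (ω / 3) * (Q ω y) ^ 4 * f y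

/-- `S f = f' - (Q_ω'/Q_ω) f`. -/
noncomputable def S (ω : ℝ) (f : ℝ → ℝ) : ℝ → ℝ :=
  fun y => deriv f y - (deriv (Q ω) y / Q ω y) * f y

/-- `S* f = -f' - (Q_ω'/Q_ω) f`. -/
noncomputable def Sstar (ω : ℝ) (f : ℝ → ℝ) : ℝ → ℝ :=
  fun y => -(deriv f y) - (deriv (Q ω) y / Q ω y) * f y

theorem aCoef_nonneg (ω : ℝ) : 0 ≤ aCoef ω := Real.sqrt_nonneg _

theorem aCoef_sq {ω : ℝ} (hω : 0 ≤ ω) : aCoef ω ^ 2 = 1 + 16 * ω / 3 :=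
  Real.sq_sqrt (by positivity)

theorem one_add_aCoef_mul_cosh_pos (ω y : ℝ) : 0 < 1 + aCoef ω * Real.cosh (2 * y) := by
  have := mul_nonneg (aCoef_nonneg ω) (Real.cosh_pos (2 * y)).le
  linarith

theorem Q_sq (ω y : ℝ) : Q ω y ^ 2 = 4 / (1 + aCoef ω * Real.cosh (2 * y)) :=
  Real.sq_sqrt (div_pos four_pos (one_add_aCoef_mul_cosh_pos ω y)).le

theorem hasDerivAt_one_add_aCoef_mul_cosh (ω y : ℝ) :
    HasDerivAt (fun y => 1 + aCoef ω * Real.cosh (2 * y))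
      (2 * (aCoef ω * Real.sinh (2 * y))) y := by
  have h := (((hasDerivAt_id y).const_mul 2).cosh.const_mul (aCoef ω)).const_add 1
  exact h.congr_deriv (by simp; ring)

/-- The logarithmic derivative of `Q_ω`. -/
theorem deriv_Q_div_Q (ω y : ℝ) :
    deriv (Q ω) y / Q ω y =
      -(aCoef ω * Real.sinh (2 * y)) / (1 + aCoef ω * Real.cosh (2 * y)) := by
  have hD := one_add_aCoef_mul_cosh_pos ω y
  have hq := ((hasDerivAt_const y (4 : ℝ)).div
    (hasDerivAt_one_add_aCoef_mul_cosh ω y) hD.ne').sqrt (div_pos four_pos hD).ne'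
  have hQ : HasDerivAt (Q ω) _ y := hq
  rw [hQ.deriv]
  have hQ2 := Q_sq ω y
  simp only [Pi.div_apply]
  change _ / (2 * Q ω y) / Q ω y = _
  rw [div_div, mul_assoc, ← sq, hQ2]
  field_simp
  ring

theorem hasDerivAt_deriv_Q_div_Q (ω y : ℝ) :
    HasDerivAt (fun y => deriv (Q ω) y / Q ω y)
      (-(2 * aCoef ω * Real.cosh (2 * y) + 2 * aCoef ω ^ 2) /
        (1 + aCoef ω * Real.cosh (2 * y)) ^ 2) y := by
  simp only [deriv_Q_div_Q]
  have hs := (((hasDerivAt_id y).const_mul 2).sinh.const_mul (aCoef ω)).neg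
  refine (hs.div (hasDerivAt_one_add_aCoef_mul_cosh ω y)
    (one_add_aCoef_mul_cosh_pos ω y).ne').congr_deriv ?_
  congr 1
  simp only [id, mul_one, Pi.neg_apply]
  linear_combination (-2 * aCoef ω ^ 2) * Real.cosh_sq (2 * y)

theorem contDiff_deriv_Q_div_Q (ω : ℝ) {n : WithTop ℕ∞} :
    ContDiff ℝ n (fun y => deriv (Q ω) y / Q ω y) := by
  simp only [deriv_Q_div_Q]
  refine ContDiff.div ?_ ?_ fun y => (one_add_aCoef_mul_cosh_pos ω y).ne'
  · exact (contDiff_const.mul (Real.contDiff_sinh.comp (contDiff_const.mul contDiff_id))).neg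
  · exact contDiff_const.add
      (contDiff_const.mul (Real.contDiff_cosh.comp (contDiff_const.mul contDiff_id)))

/-- The Riccati identity behind `S* S = L₋`. -/
theorem deriv_add_sq_logDeriv_Q {ω : ℝ} (hω : 0 ≤ ω) (y : ℝ) :
    deriv (fun y => deriv (Q ω) y / Q ω y) y + (deriv (Q ω) y / Q ω y) ^ 2 =
      1 - Q ω y ^ 2 - ω * Q ω y ^ 4 := by
  have hD := (one_add_aCoef_mul_cosh_pos ω y).ne'
  rw [(hasDerivAt_deriv_Q_div_Q ω y).deriv, deriv_Q_div_Q,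
    show Q ω y ^ 4 = (Q ω y ^ 2) ^ 2 by ring, Q_sq]
  field_simp
  linear_combination (-3) * aCoef_sq hω - aCoef ω ^ 2 * Real.cosh_sq (2 * y)

/-- The Riccati identity behind `S S* = M₊`. -/
theorem sq_sub_deriv_logDeriv_Q {ω : ℝ} (hω : 0 ≤ ω) (y : ℝ) :
    (deriv (Q ω) y / Q ω y) ^ 2 - deriv (fun y => deriv (Q ω) y / Q ω y) y =
      1 + ω / 3 * Q ω y ^ 4 := by
  have hD := (one_add_aCoef_mul_cosh_pos ω y).ne'
  rw [(hasDerivAt_deriv_Q_div_Q ω y).deriv, deriv_Q_div_Q,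
    show Q ω y ^ 4 = (Q ω y ^ 2) ^ 2 by ring, Q_sq]
  field_simp
  linear_combination 3 * aCoef_sq hω - 3 * aCoef ω ^ 2 * Real.cosh_sq (2 * y)

theorem Sstar_S {ω : ℝ} (hω : 0 ≤ ω) {f : ℝ → ℝ} (hf : Differentiable ℝ f)
    (hf' : Differentiable ℝ (deriv f)) : Sstar ω (S ω f) = Lm ω f := by
  funext y
  have hw := (hasDerivAt_deriv_Q_div_Q ω y).differentiableAt.hasDerivAt
  have hS : HasDerivAt (S ω f) _ y := (hf' y).hasDerivAt.sub (hw.mul (hf y).hasDerivAt)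
  simp only [Sstar, Lm, hS.deriv]
  simp only [S]
  linear_combination f y * deriv_add_sq_logDeriv_Q hω y

theorem S_Sstar {ω : ℝ} (hω : 0 ≤ ω) {f : ℝ → ℝ} (hf : Differentiable ℝ f)
    (hf' : Differentiable ℝ (deriv f)) : S ω (Sstar ω f) = Mp ω f := by
  funext y
  have hw := (hasDerivAt_deriv_Q_div_Q ω y).differentiableAt.hasDerivAt
  have hS : HasDerivAt (Sstar ω f) _ y :=
    (hf' y).hasDerivAt.neg.sub (hw.mul (hf y).hasDerivAt)
  simp only [S, Mp, hS.deriv]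
  simp only [Sstar]
  linear_combination f y * sq_sub_deriv_logDeriv_Q hω y

theorem contDiff_S (ω : ℝ) {f : ℝ → ℝ} (hf : ContDiff ℝ (⊤ : ℕ∞) f) :
    ContDiff ℝ (⊤ : ℕ∞) (S ω f) :=
  (contDiff_infty_iff_deriv.1 hf).2.sub ((contDiff_deriv_Q_div_Q ω).mul hf)

/-- The factorizations `S* S = L₋`, `S S* = M₊`, and the conjugation `S L₋ = M₊ S`. -/
theorem factorization_identities (ω : ℝ) (hω : 0 < ω) (f : ℝ → ℝ) (hf : ContDiff ℝ (⊤ : ℕ∞) f) :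
    (∀ y : ℝ, Sstar ω (S ω f) y = Lm ω f y) ∧
    (∀ y : ℝ, S ω (Sstar ω f) y = Mp ω f y) ∧
    (∀ y : ℝ, S ω (Lm ω f) y = Mp ω (S ω f) y) := by
  have differentiable_pair {g : ℝ → ℝ} (hg : ContDiff ℝ (⊤ : ℕ∞) g) :
      Differentiable ℝ g ∧ Differentiable ℝ (deriv g) :=
    have h := contDiff_infty_iff_deriv.1 hg
    ⟨h.1, (contDiff_infty_iff_deriv.1 h.2).1⟩
  obtain ⟨hf₁, hf₂⟩ := differentiable_pair hf
  obtain ⟨hS₁, hS₂⟩ := differentiable_pair (contDiff_S ω hf)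
  refine ⟨congrFun (Sstar_S hω.le hf₁ hf₂), congrFun (S_Sstar hω.le hf₁ hf₂), fun y => ?_⟩
  rw [← Sstar_S hω.le hf₁ hf₂, S_Sstar hω.le hS₁ hS₂]
end

section
/- There exist constants C > 0 and ω₁ > 0 such that for every ω ∈ (0, ω₁) and every λ ∈ [3/4, 1], setting τ = sqrt(2λ − 1), there exist smooth, even, bounded functions h₁, h₂ : ℝ → ℝ satisfying M₊h₁ = 2λ·h₂ and M₋h₂ = 2λ·h₁ on ℝ, with |h₁(y) + cos(τ·y)| ≤ C·ω and |h₂(y) + cos(τ·y)| ≤ C·ω for all y ∈ ℝ. -/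
open Real

/-- `M₋ f = -f'' + f - ω Q_ω⁴ f`. -/
noncomputable def Mm (ω : ℝ) (f : ℝ → ℝ) : ℝ → ℝ :=
  fun y => -(deriv (deriv f) y) + f y - ω * (Q ω y) ^ 4 * f y

open MeasureTheory
open scoped BoundedContinuousFunction

/-- A Neumann-series type statement: `u = u₀ + ε K u` is solvable for a bounded additive `K` and
small `ε`, and the solution is close to `u₀`. -/
theorem exists_eq_add_smul_of_bounded {X E : Type*} [TopologicalSpace X]
    [NormedAddCommGroup E] [NormedSpace ℝ E] [CompleteSpace E]
    (K : (X →ᵇ E) → X → E) {c ε : ℝ} (hcont : ∀ u, Continuous (K u))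
    (hsub : ∀ u v x, K (u - v) x = K u x - K v x) (hbound : ∀ u x, ‖K u x‖ ≤ c * ‖u‖)
    (hc : 0 ≤ c) (hε : 0 ≤ ε) (hεc : ε * c ≤ 1 / 2) (u₀ : X →ᵇ E) :
    ∃ u : X →ᵇ E, (∀ x, u x = u₀ x + ε • K u x) ∧
      ∀ x, ‖u x - u₀ x‖ ≤ ε * c * (2 * ‖u₀‖) := by
  let L : (X →ᵇ E) → (X →ᵇ E) := fun u =>
    BoundedContinuousFunction.ofNormedAddCommGroup (K u) (hcont u) (c * ‖u‖) (hbound u)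
  let Φ : (X →ᵇ E) → (X →ᵇ E) := fun u => u₀ + ε • L u
  have hL : ∀ u, ‖L u‖ ≤ c * ‖u‖ := fun u =>
    BoundedContinuousFunction.norm_ofNormedAddCommGroup_le (hcont u) (by positivity) (hbound u)
  have hLsub : ∀ u v, L u - L v = L (u - v) := by
    intro u v
    ext x
    exact (hsub u v x).symm
  have hΦ : ContractingWith (1 / 2) Φ := by
    refine ⟨by norm_num, LipschitzWith.of_dist_le_mul fun u v => ?_⟩
    rw [dist_eq_norm, dist_eq_norm]
    have : Φ u - Φ v = ε • L (u - v) := by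
      rw [← hLsub, smul_sub]
      simp only [Φ]
      abel
    rw [this, norm_smul, Real.norm_of_nonneg hε]
    calc ε * ‖L (u - v)‖ ≤ ε * (c * ‖u - v‖) := by gcongr; exact hL _
      _ = (ε * c) * ‖u - v‖ := by ring
      _ ≤ _ := by
        gcongr
        simpa using hεc
  obtain ⟨u, hu⟩ : ∃ u, Φ u = u := ⟨_, hΦ.fixedPoint_isFixedPt⟩
  have hux : ∀ x, u x = u₀ x + ε • K u x := fun x => (congrArg (fun w => w x) hu).symm
  have hdiff : ‖u - u₀‖ ≤ ε * (c * ‖u‖) := by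
    have : u - u₀ = ε • L u := by
      nth_rewrite 1 [← hu]
      simp [Φ]
    rw [this, norm_smul, Real.norm_of_nonneg hε]
    gcongr
    exact hL u
  have hnorm : ‖u‖ ≤ 2 * ‖u₀‖ := by
    have h1 : ‖u‖ ≤ ‖u - u₀‖ + ‖u₀‖ := by simpa using norm_add_le (u - u₀) u₀
    nlinarith [norm_nonneg u]
  refine ⟨u, hux, fun x => ((u - u₀).norm_coe_le_norm x).trans (hdiff.trans ?_)⟩
  rw [← mul_assoc]
  gcongr

/-- The solution of `f'' + τ² f = F`, `f(0) = f'(0) = 0`. -/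
noncomputable def greenSin (τ : ℝ) (F : ℝ → ℝ) (y : ℝ) : ℝ :=
  (sin (τ * y) * (∫ s in (0 : ℝ)..y, cos (τ * s) * F s) -
    cos (τ * y) * ∫ s in (0 : ℝ)..y, sin (τ * s) * F s) / τ

/-- The derivative of `greenSin τ F`. -/
noncomputable def greenSinDeriv (τ : ℝ) (F : ℝ → ℝ) (y : ℝ) : ℝ :=
  cos (τ * y) * (∫ s in (0 : ℝ)..y, cos (τ * s) * F s) +
    sin (τ * y) * ∫ s in (0 : ℝ)..y, sin (τ * s) * F s

theorem hasDerivAt_integral_of_continuous {f : ℝ → ℝ} (hf : Continuous f) (y : ℝ) :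
    HasDerivAt (fun y => ∫ s in (0 : ℝ)..y, f s) (f y) y :=
  (hf.integral_hasStrictDerivAt 0 y).hasDerivAt

theorem hasDerivAt_sin_mul (τ y : ℝ) : HasDerivAt (fun y => sin (τ * y)) (τ * cos (τ * y)) y := by
  simpa [mul_comm] using ((hasDerivAt_id y).const_mul τ).sin

theorem hasDerivAt_cos_mul (τ y : ℝ) :
    HasDerivAt (fun y => cos (τ * y)) (-(τ * sin (τ * y))) y := by
  simpa [mul_comm] using ((hasDerivAt_id y).const_mul τ).cos

theorem hasDerivAt_greenSin {τ : ℝ} (hτ : τ ≠ 0) {F : ℝ → ℝ} (hF : Continuous F) (y : ℝ) :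
    HasDerivAt (greenSin τ F) (greenSinDeriv τ F y) y := by
  have hA := hasDerivAt_integral_of_continuous (f := fun s => cos (τ * s) * F s) (by fun_prop) y
  have hB := hasDerivAt_integral_of_continuous (f := fun s => sin (τ * s) * F s) (by fun_prop) y
  refine ((((hasDerivAt_sin_mul τ y).mul hA).sub
    ((hasDerivAt_cos_mul τ y).mul hB)).div_const τ).congr_deriv ?_
  unfold greenSinDeriv
  field_simp
  ring

theorem hasDerivAt_greenSinDeriv (τ : ℝ) {F : ℝ → ℝ} (hF : Continuous F) (y : ℝ) :
    HasDerivAt (greenSinDeriv τ F) (F y - τ ^ 2 * greenSin τ F y) y := by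
  have hA := hasDerivAt_integral_of_continuous (f := fun s => cos (τ * s) * F s) (by fun_prop) y
  have hB := hasDerivAt_integral_of_continuous (f := fun s => sin (τ * s) * F s) (by fun_prop) y
  refine (((hasDerivAt_cos_mul τ y).mul hA).add
    ((hasDerivAt_sin_mul τ y).mul hB)).congr_deriv ?_
  unfold greenSin
  field_simp
  linear_combination F y * sin_sq_add_cos_sq (τ * y)

theorem greenSin_sub (τ : ℝ) {F G : ℝ → ℝ} (hF : Continuous F) (hG : Continuous G) (y : ℝ) :
    greenSin τ (fun s => F s - G s) y = greenSin τ F y - greenSin τ G y := by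
  unfold greenSin
  simp only [mul_sub]
  rw [intervalIntegral.integral_sub, intervalIntegral.integral_sub]
  · ring
  all_goals exact Continuous.intervalIntegrable (by fun_prop) _ _

theorem abs_integral_le_of_decay {N : ℝ} (hN : 0 ≤ N) {f : ℝ → ℝ}
    (hb : ∀ s, |f s| ≤ N * (1 + s ^ 2)⁻¹) (y : ℝ) :
    |∫ s in (0 : ℝ)..y, f s| ≤ N * 2 := by
  have hcont : Continuous fun s : ℝ => N * (1 + s ^ 2)⁻¹ :=
    continuous_const.mul ((by fun_prop : Continuous fun s : ℝ => 1 + s ^ 2).inv₀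
      fun s => by positivity)
  have h := intervalIntegral.norm_integral_le_abs_of_norm_le (a := 0) (b := y) (μ := volume)
    (f := f) (Filter.Eventually.of_forall hb) (hcont.intervalIntegrable 0 y)
  rw [Real.norm_eq_abs, intervalIntegral.integral_const_mul, integral_inv_one_add_sq,
    arctan_zero, sub_zero, abs_mul, abs_of_nonneg hN] at h
  refine h.trans (mul_le_mul_of_nonneg_left ?_ hN)
  rw [abs_le]
  constructor <;> linarith [arctan_lt_pi_div_two y, neg_pi_div_two_lt_arctan y, pi_le_four]

theorem abs_greenSin_le {τ N : ℝ} (hτ : 1 / 2 ≤ τ) (hN : 0 ≤ N) {F : ℝ → ℝ}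
    (hb : ∀ s, |F s| ≤ N * (1 + s ^ 2)⁻¹) (y : ℝ) : |greenSin τ F y| ≤ 8 * N := by
  have hmul : ∀ {a b c : ℝ}, |a| ≤ 1 → |b| ≤ c → |a * b| ≤ c := by
    intro a b c ha hb'
    rw [abs_mul]
    nlinarith [abs_nonneg a, abs_nonneg b]
  have hA := hmul (abs_sin_le_one (τ * y))
    (abs_integral_le_of_decay hN (fun s => hmul (abs_cos_le_one (τ * s)) (hb s)) y)
  have hB := hmul (abs_cos_le_one (τ * y))
    (abs_integral_le_of_decay hN (fun s => hmul (abs_sin_le_one (τ * s)) (hb s)) y)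
  unfold greenSin
  rw [abs_div, abs_of_pos (by linarith : 0 < τ), div_le_iff₀ (by linarith)]
  refine (abs_sub _ _).trans ?_
  nlinarith

/-- The bounded solution of `f' = -κ f + G`. -/
noncomputable def expTail (κ : ℝ) (G : ℝ → ℝ) (y : ℝ) : ℝ :=
  exp (-(κ * y)) * ∫ s in Set.Iic y, exp (κ * s) * G s

theorem integrableOn_exp_mul_of_bounded {κ M : ℝ} (hκ : 0 < κ) {G : ℝ → ℝ} (hG : Continuous G)
    (hb : ∀ s, |G s| ≤ M) (y : ℝ) :
    IntegrableOn (fun s => exp (κ * s) * G s) (Set.Iic y) :=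
  (integrableOn_exp_mul_Iic hκ y).mul_bdd hG.aestronglyMeasurable
    (Filter.Eventually.of_forall hb)

theorem hasDerivAt_expTail {κ M : ℝ} (hκ : 0 < κ) {G : ℝ → ℝ} (hG : Continuous G)
    (hb : ∀ s, |G s| ≤ M) (y : ℝ) :
    HasDerivAt (expTail κ G) (G y - κ * expTail κ G y) y := by
  have hint := integrableOn_exp_mul_of_bounded hκ hG hb
  have hI : HasDerivAt (fun y => ∫ s in Set.Iic y, exp (κ * s) * G s) (exp (κ * y) * G y) y := by
    have h := (hasDerivAt_integral_of_continuous (f := fun s => exp (κ * s) * G s)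
      (by fun_prop) y).const_add (∫ s in Set.Iic 0, exp (κ * s) * G s)
    refine h.congr_of_eventuallyEq (Filter.Eventually.of_forall fun z => ?_)
    linarith [intervalIntegral.integral_Iic_sub_Iic (hint 0) (hint z)]
  have hE : HasDerivAt (fun y => exp (-(κ * y))) (-(κ * exp (-(κ * y)))) y := by
    simpa [mul_comm] using ((hasDerivAt_id y).const_mul κ).neg.exp
  refine (hE.mul hI).congr_deriv ?_
  unfold expTail
  have : exp (-(κ * y)) * exp (κ * y) = 1 := by rw [← exp_add]; simp
  linear_combination G y * this

theorem expTail_sub {κ M N : ℝ} (hκ : 0 < κ) {F G : ℝ → ℝ} (hF : Continuous F)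
    (hG : Continuous G) (hFb : ∀ s, |F s| ≤ M) (hGb : ∀ s, |G s| ≤ N) (y : ℝ) :
    expTail κ (fun s => F s - G s) y = expTail κ F y - expTail κ G y := by
  unfold expTail
  simp only [mul_sub]
  rw [integral_sub (integrableOn_exp_mul_of_bounded hκ hF hFb y)
    (integrableOn_exp_mul_of_bounded hκ hG hGb y), mul_sub]

theorem abs_expTail_le {κ M : ℝ} (hκ : 0 < κ) {G : ℝ → ℝ} (hb : ∀ s, |G s| ≤ M) (y : ℝ) :
    |expTail κ G y| ≤ M / κ := by
  have h : ‖∫ s in Set.Iic y, exp (κ * s) * G s‖ ≤ ∫ s in Set.Iic y, exp (κ * s) * M := by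
    refine norm_integral_le_of_norm_le ((integrableOn_exp_mul_Iic hκ y).mul_const M)
      (Filter.Eventually.of_forall fun s => ?_)
    rw [norm_mul, Real.norm_of_nonneg (exp_pos _).le]
    exact mul_le_mul_of_nonneg_left (hb s) (exp_pos _).le
  rw [integral_mul_const, integral_exp_mul_Iic hκ, Real.norm_eq_abs] at h
  unfold expTail
  rw [abs_mul, abs_of_pos (exp_pos _)]
  refine (mul_le_mul_of_nonneg_left h (exp_pos _).le).trans_eq ?_
  rw [exp_neg]
  field_simp

/-- The bounded solution of `f'' = κ² f + G`. -/
noncomputable def greenExp (κ : ℝ) (G : ℝ → ℝ) (y : ℝ) : ℝ :=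
  -(expTail κ G y + expTail κ (fun s => G (-s)) (-y)) / (2 * κ)

/-- The derivative of `greenExp κ G`. -/
noncomputable def greenExpDeriv (κ : ℝ) (G : ℝ → ℝ) (y : ℝ) : ℝ :=
  (expTail κ G y - expTail κ (fun s => G (-s)) (-y)) / 2

theorem hasDerivAt_comp_neg {f : ℝ → ℝ} {f' y : ℝ} (hf : HasDerivAt f f' (-y)) :
    HasDerivAt (fun z => f (-z)) (-f') y := by
  exact (hf.comp y (hasDerivAt_neg y)).congr_deriv (mul_neg_one f')

theorem hasDerivAt_expTail_neg {κ M : ℝ} (hκ : 0 < κ) {G : ℝ → ℝ} (hG : Continuous G)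
    (hb : ∀ s, |G s| ≤ M) (y : ℝ) :
    HasDerivAt (fun y => expTail κ (fun s => G (-s)) (-y))
      (κ * expTail κ (fun s => G (-s)) (-y) - G y) y := by
  refine (hasDerivAt_comp_neg (hasDerivAt_expTail hκ (hG.comp continuous_neg)
    (fun s => hb (-s)) (-y))).congr_deriv ?_
  simp [Function.comp_def]

theorem hasDerivAt_greenExp {κ M : ℝ} (hκ : 0 < κ) {G : ℝ → ℝ} (hG : Continuous G)
    (hb : ∀ s, |G s| ≤ M) (y : ℝ) :
    HasDerivAt (greenExp κ G) (greenExpDeriv κ G y) y := by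
  refine ((((hasDerivAt_expTail hκ hG hb y).add
    (hasDerivAt_expTail_neg hκ hG hb y)).neg).div_const (2 * κ)).congr_deriv ?_
  unfold greenExpDeriv
  field_simp
  ring

theorem hasDerivAt_greenExpDeriv {κ M : ℝ} (hκ : 0 < κ) {G : ℝ → ℝ} (hG : Continuous G)
    (hb : ∀ s, |G s| ≤ M) (y : ℝ) :
    HasDerivAt (greenExpDeriv κ G) (κ ^ 2 * greenExp κ G y + G y) y := by
  refine ((((hasDerivAt_expTail hκ hG hb y).sub
    (hasDerivAt_expTail_neg hκ hG hb y))).div_const 2).congr_deriv ?_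
  unfold greenExp
  field_simp
  ring

theorem greenExp_sub {κ M N : ℝ} (hκ : 0 < κ) {F G : ℝ → ℝ} (hF : Continuous F)
    (hG : Continuous G) (hFb : ∀ s, |F s| ≤ M) (hGb : ∀ s, |G s| ≤ N) (y : ℝ) :
    greenExp κ (fun s => F s - G s) y = greenExp κ F y - greenExp κ G y := by
  unfold greenExp
  have hneg := expTail_sub hκ (hF.comp continuous_neg) (hG.comp continuous_neg)
    (fun s => hFb (-s)) (fun s => hGb (-s)) (-y)
  simp only [Function.comp_def] at hneg
  rw [expTail_sub hκ hF hG hFb hGb, hneg]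
  ring

theorem abs_greenExp_le {κ M : ℝ} (hκ : 1 ≤ κ) {G : ℝ → ℝ} (hb : ∀ s, |G s| ≤ M) (y : ℝ) :
    |greenExp κ G y| ≤ M := by
  have h0 : 0 < κ := by linarith
  have hM : 0 ≤ M := (abs_nonneg _).trans (hb 0)
  have hdiv : M / κ ≤ M := div_le_self hM hκ
  have h1 := abs_expTail_le h0 hb y
  have h2 := abs_expTail_le h0 (fun s => hb (-s)) (-y)
  unfold greenExp
  rw [abs_div, abs_neg, abs_of_pos (by linarith : 0 < 2 * κ), div_le_iff₀ (by linarith)]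
  refine (abs_add_le _ _).trans ?_
  nlinarith

/-- Continuous solutions of a second-order linear system with smooth coefficients are smooth. -/
theorem contDiff_of_linear_system {a b c d f f' g g' : ℝ → ℝ}
    (ha : ContDiff ℝ (⊤ : ℕ∞) a) (hb : ContDiff ℝ (⊤ : ℕ∞) b)
    (hc : ContDiff ℝ (⊤ : ℕ∞) c) (hd : ContDiff ℝ (⊤ : ℕ∞) d)
    (hf : ∀ y, HasDerivAt f (f' y) y) (hf' : ∀ y, HasDerivAt f' (a y * f y + b y * g y) y)
    (hg : ∀ y, HasDerivAt g (g' y) y) (hg' : ∀ y, HasDerivAt g' (c y * f y + d y * g y) y) :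
    ContDiff ℝ (⊤ : ℕ∞) f ∧ ContDiff ℝ (⊤ : ℕ∞) g := by
  have step : ∀ {n : ℕ} {h h' : ℝ → ℝ}, (∀ y, HasDerivAt h (h' y) y) → ContDiff ℝ n h' →
      ContDiff ℝ (n + 1 : ℕ) h := by
    intro n h h' hh hn
    have hderiv : deriv h = h' := funext fun y => (hh y).deriv
    rw [Nat.cast_add_one, contDiff_succ_iff_deriv, hderiv]
    exact ⟨fun y => (hh y).differentiableAt, by simp, hn⟩
  have key : ∀ n : ℕ, ContDiff ℝ n f ∧ ContDiff ℝ n f' ∧ ContDiff ℝ n g ∧ ContDiff ℝ n g' := by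
    intro n
    induction n with
    | zero =>
      have hcont : ∀ {h h' : ℝ → ℝ}, (∀ y, HasDerivAt h (h' y) y) → ContDiff ℝ (0 : ℕ) h :=
        fun hh => contDiff_zero.2 (continuous_iff_continuousAt.2 fun y => (hh y).continuousAt)
      exact ⟨hcont hf, hcont hf', hcont hg, hcont hg'⟩
    | succ n ih =>
      obtain ⟨h1, h2, h3, h4⟩ := ih
      have hle : ((n : ℕ) : WithTop ℕ∞) ≤ (⊤ : ℕ∞) := by exact_mod_cast le_top
      exact ⟨step hf h2, step hf' (((ha.of_le hle).mul h1).add ((hb.of_le hle).mul h3)),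
        step hg h4, step hg' (((hc.of_le hle).mul h1).add ((hd.of_le hle).mul h3))⟩
  exact ⟨contDiff_infty.2 fun n => (key n).1, contDiff_infty.2 fun n => (key n).2.2.1⟩

theorem one_le_aCoef {ω : ℝ} (hω : 0 ≤ ω) : 1 ≤ aCoef ω :=
  Real.one_le_sqrt.2 (by linarith)

theorem Q_pow_four {ω : ℝ} (hω : 0 ≤ ω) (y : ℝ) :
    Q ω y ^ 4 = (4 / (1 + aCoef ω * cosh (2 * y))) ^ 2 := by
  have ha := one_le_aCoef hω
  have hpos : 0 ≤ 4 / (1 + aCoef ω * cosh (2 * y)) := by positivity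
  unfold Q
  rw [show (4 : ℕ) = 2 * 2 from rfl, pow_mul, Real.sq_sqrt hpos]

theorem contDiff_Q_pow_four {ω : ℝ} (hω : 0 ≤ ω) : ContDiff ℝ (⊤ : ℕ∞) fun y => Q ω y ^ 4 := by
  have ha := one_le_aCoef hω
  simp only [Q_pow_four hω]
  refine (contDiff_const.div ?_ fun y => ?_).pow 2
  · exact contDiff_const.add (contDiff_const.mul (contDiff_const.mul contDiff_id).cosh)
  · positivity

theorem Q_neg (ω y : ℝ) : Q ω (-y) = Q ω y := by
  simp [Q]

theorem Q_pow_four_le {ω : ℝ} (hω : 0 ≤ ω) (y : ℝ) : Q ω y ^ 4 ≤ 4 * (1 + y ^ 2)⁻¹ := by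
  have ha := one_le_aCoef hω
  have hsinh : y ^ 2 ≤ sinh y ^ 2 := by
    rw [sq_le_sq, abs_sinh]
    exact self_le_sinh_iff.2 (abs_nonneg y)
  have hden : 2 * (1 + y ^ 2) ≤ 1 + aCoef ω * cosh (2 * y) := by
    have h1 : cosh (2 * y) = 1 + 2 * sinh y ^ 2 := by
      rw [cosh_two_mul, cosh_sq]
      ring
    have h2 := one_le_cosh (2 * y)
    nlinarith
  have hle : 4 / (1 + aCoef ω * cosh (2 * y)) ≤ 2 * (1 + y ^ 2)⁻¹ := by
    calc 4 / (1 + aCoef ω * cosh (2 * y)) ≤ 4 / (2 * (1 + y ^ 2)) := by gcongr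
      _ = 2 * (1 + y ^ 2)⁻¹ := by field_simp; norm_num
  have hinv : (1 + y ^ 2)⁻¹ ≤ 1 := inv_le_one_of_one_le₀ (by nlinarith)
  have hinv0 : 0 ≤ (1 + y ^ 2)⁻¹ := by positivity
  rw [Q_pow_four hω]
  calc (4 / (1 + aCoef ω * cosh (2 * y))) ^ 2 ≤ (2 * (1 + y ^ 2)⁻¹) ^ 2 := by gcongr
    _ ≤ 4 * (1 + y ^ 2)⁻¹ := by nlinarith

/-- The integral operator whose kernel inverts the constant-coefficient part of the system
satisfied by `(h₁ + h₂, h₁ - h₂)`. -/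
noncomputable def perturbation (τ κ : ℝ) (V : ℝ → ℝ) (u : ℝ →ᵇ ℝ × ℝ) (y : ℝ) : ℝ × ℝ :=
  (greenSin τ (fun s => V s * ((2 * (u s).2 - (u s).1) / 3)) y,
    greenExp κ (fun s => V s * ((2 * (u s).1 - (u s).2) / 3)) y)

theorem exists_perturbed_pair {τ κ ε : ℝ} {V : ℝ → ℝ} (hτ : 1 / 2 ≤ τ) (hκ : 1 ≤ κ)
    (hV : Continuous V) (hV0 : ∀ s, 0 ≤ V s) (hVb : ∀ s, V s ≤ 4 * (1 + s ^ 2)⁻¹)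
    (hε : 0 ≤ ε) (hε' : ε ≤ 1 / 64) :
    ∃ p p' q q' : ℝ → ℝ, (∀ y, HasDerivAt p (p' y) y) ∧ (∀ y, HasDerivAt q (q' y) y) ∧
      (∀ y, HasDerivAt p' (-(τ ^ 2 * p y) + ε * (V y * ((2 * q y - p y) / 3))) y) ∧
      (∀ y, HasDerivAt q' (κ ^ 2 * q y + ε * (V y * ((2 * p y - q y) / 3))) y) ∧
      (∀ y, |p y + 2 * cos (τ * y)| ≤ 128 * ε) ∧ ∀ y, |q y| ≤ 128 * ε := by
  have hτ0 : τ ≠ 0 := by linarith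
  have hκ0 : 0 < κ := by linarith
  have hVle : ∀ s, V s ≤ 4 := fun s => (hVb s).trans (by
    have : (1 + s ^ 2)⁻¹ ≤ 1 := inv_le_one_of_one_le₀ (by nlinarith [sq_nonneg s])
    linarith)
  have hu1 : ∀ (u : ℝ →ᵇ ℝ × ℝ) s, |(u s).1| ≤ ‖u‖ := fun u s =>
    (norm_fst_le (u s)).trans (u.norm_coe_le_norm s)
  have hu2 : ∀ (u : ℝ →ᵇ ℝ × ℝ) s, |(u s).2| ≤ ‖u‖ := fun u s =>
    (norm_snd_le (u s)).trans (u.norm_coe_le_norm s)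
  have hcomb : ∀ {x z m : ℝ}, |x| ≤ m → |z| ≤ m → |(2 * x - z) / 3| ≤ m := by
    intro x z m hx hz
    rw [abs_le] at *
    constructor <;> linarith [hx.1, hx.2, hz.1, hz.2]
  have hFb : ∀ (u : ℝ →ᵇ ℝ × ℝ) s,
      |V s * ((2 * (u s).2 - (u s).1) / 3)| ≤ 4 * ‖u‖ * (1 + s ^ 2)⁻¹ := by
    intro u s
    rw [abs_mul, abs_of_nonneg (hV0 s)]
    calc _ ≤ (4 * (1 + s ^ 2)⁻¹) * ‖u‖ :=
          mul_le_mul (hVb s) (hcomb (hu2 u s) (hu1 u s)) (abs_nonneg _) (by positivity)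
      _ = _ := by ring
  have hGb : ∀ (u : ℝ →ᵇ ℝ × ℝ) s,
      |V s * ((2 * (u s).1 - (u s).2) / 3)| ≤ 4 * ‖u‖ := by
    intro u s
    rw [abs_mul, abs_of_nonneg (hV0 s)]
    exact mul_le_mul (hVle s) (hcomb (hu1 u s) (hu2 u s)) (abs_nonneg _) (by positivity)
  have hFc : ∀ u : ℝ →ᵇ ℝ × ℝ, Continuous fun s => V s * ((2 * (u s).2 - (u s).1) / 3) :=
    fun u => by fun_prop
  have hGc : ∀ u : ℝ →ᵇ ℝ × ℝ, Continuous fun s => V s * ((2 * (u s).1 - (u s).2) / 3) :=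
    fun u => by fun_prop
  have hcont : ∀ u, Continuous (perturbation τ κ V u) := fun u =>
    (continuous_iff_continuousAt.2 fun y =>
      (hasDerivAt_greenSin hτ0 (hFc u) y).continuousAt).prodMk
    (continuous_iff_continuousAt.2 fun y =>
      (hasDerivAt_greenExp hκ0 (hGc u) (hGb u) y).continuousAt)
  have hsub : ∀ u v x, perturbation τ κ V (u - v) x =
      perturbation τ κ V u x - perturbation τ κ V v x := by
    intro u v x
    refine Prod.ext ?_ ?_
    · refine Eq.trans ?_ (greenSin_sub τ (hFc u) (hFc v) x)
      simp only [perturbation, BoundedContinuousFunction.coe_sub, Pi.sub_apply, Prod.fst_sub,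
        Prod.snd_sub]
      congr 1
      funext s
      ring
    · refine Eq.trans ?_ (greenExp_sub hκ0 (hGc u) (hGc v) (hGb u) (hGb v) x)
      simp only [perturbation, BoundedContinuousFunction.coe_sub, Pi.sub_apply, Prod.fst_sub,
        Prod.snd_sub]
      congr 1
      funext s
      ring
  have hbound : ∀ u x, ‖perturbation τ κ V u x‖ ≤ 32 * ‖u‖ := by
    intro u x
    have hn := norm_nonneg u
    refine max_le ?_ ?_
    · have := abs_greenSin_le hτ (by positivity) (hFb u) x
      change |_| ≤ _
      exact this.trans (by linarith)
    · have := abs_greenExp_le hκ (hGb u) x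
      change |_| ≤ _
      exact this.trans (by linarith)
  have hb₀ : ∀ y, ‖((-2 * cos (τ * y), 0) : ℝ × ℝ)‖ ≤ 2 := by
    intro y
    refine max_le ?_ (by simp)
    rw [norm_mul]
    have := abs_cos_le_one (τ * y)
    simp only [norm_neg, Real.norm_ofNat, Real.norm_eq_abs]
    linarith
  let u₀ : ℝ →ᵇ ℝ × ℝ := BoundedContinuousFunction.ofNormedAddCommGroup
    (fun y => (-2 * cos (τ * y), 0)) (by fun_prop) 2 hb₀
  have hu₀ : ‖u₀‖ ≤ 2 :=
    BoundedContinuousFunction.norm_ofNormedAddCommGroup_le _ (by norm_num) hb₀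
  obtain ⟨u, hu, hd⟩ := exists_eq_add_smul_of_bounded (perturbation τ κ V) hcont hsub hbound
    (by norm_num) hε (by linarith) u₀
  have hd' : ∀ y, ‖u y - u₀ y‖ ≤ 128 * ε := fun y => (hd y).trans (by nlinarith)
  have hp : (fun y => (u y).1) = fun y => -2 * cos (τ * y) +
      ε * greenSin τ (fun s => V s * ((2 * (u s).2 - (u s).1) / 3)) y :=
    funext fun y => congrArg Prod.fst (hu y)
  have hq : (fun y => (u y).2) = fun y =>
      ε * greenExp κ (fun s => V s * ((2 * (u s).1 - (u s).2) / 3)) y :=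
    funext fun y => (congrArg Prod.snd (hu y)).trans (zero_add _)
  refine ⟨fun y => (u y).1,
    fun y => 2 * τ * sin (τ * y) +
      ε * greenSinDeriv τ (fun s => V s * ((2 * (u s).2 - (u s).1) / 3)) y,
    fun y => (u y).2,
    fun y => ε * greenExpDeriv κ (fun s => V s * ((2 * (u s).1 - (u s).2) / 3)) y,
    fun y => ?_, fun y => ?_, fun y => ?_, fun y => ?_, fun y => ?_, fun y => ?_⟩
  · rw [hp]
    refine (((hasDerivAt_cos_mul τ y).const_mul (-2)).add
      ((hasDerivAt_greenSin hτ0 (hFc u) y).const_mul ε)).congr_deriv ?_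
    ring
  · rw [hq]
    exact (hasDerivAt_greenExp hκ0 (hGc u) (hGb u) y).const_mul ε
  · refine (((hasDerivAt_sin_mul τ y).const_mul (2 * τ)).add
      ((hasDerivAt_greenSinDeriv τ (hFc u) y).const_mul ε)).congr_deriv ?_
    have := congrFun hp y
    linear_combination τ ^ 2 * this
  · refine ((hasDerivAt_greenExpDeriv hκ0 (hGc u) (hGb u) y).const_mul ε).congr_deriv ?_
    have := congrFun hq y
    linear_combination -κ ^ 2 * this
  · have := (norm_fst_le (u y - u₀ y)).trans (hd' y)
    have h0 : (u₀ y).1 = -2 * cos (τ * y) := rfl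
    rwa [Prod.fst_sub, h0, Real.norm_eq_abs, neg_mul, sub_neg_eq_add] at this
  · have := (norm_snd_le (u y - u₀ y)).trans (hd' y)
    have h0 : (u₀ y).2 = 0 := rfl
    rwa [Prod.snd_sub, h0, sub_zero, Real.norm_eq_abs] at this

/-- Existence of bounded solutions `(h₁, h₂)` of `M₊ h₁ = 2λ h₂`, `M₋ h₂ = 2λ h₁`,
close to `(-cos(τy), -cos(τy))` with `τ = √(2λ-1)`. -/
theorem transformed_fermi_functions :
    ∃ C > (0 : ℝ), ∃ ω₁ > (0 : ℝ), ∀ ω ∈ Set.Ioo (0 : ℝ) ω₁,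
      ∀ lam ∈ Set.Icc (3 / 4 : ℝ) 1,
        ∃ h₁ h₂ : ℝ → ℝ,
          ContDiff ℝ (⊤ : ℕ∞) h₁ ∧ ContDiff ℝ (⊤ : ℕ∞) h₂ ∧
          (∀ y : ℝ, h₁ (-y) = h₁ y) ∧ (∀ y : ℝ, h₂ (-y) = h₂ y) ∧
          (∃ M : ℝ, ∀ y : ℝ, |h₁ y| ≤ M) ∧ (∃ M : ℝ, ∀ y : ℝ, |h₂ y| ≤ M) ∧
          (∀ y : ℝ, Mp ω h₁ y = 2 * lam * h₂ y) ∧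
          (∀ y : ℝ, Mm ω h₂ y = 2 * lam * h₁ y) ∧
          (∀ y : ℝ, |h₁ y + Real.cos (Real.sqrt (2 * lam - 1) * y)| ≤ C * ω) ∧
          (∀ y : ℝ, |h₂ y + Real.cos (Real.sqrt (2 * lam - 1) * y)| ≤ C * ω) := by
  refine ⟨128, by norm_num, 1 / 64, by norm_num, ?_⟩
  rintro ω ⟨hω, hω'⟩ lam ⟨hl, hl'⟩
  set τ := Real.sqrt (2 * lam - 1)
  set κ := Real.sqrt (2 * lam + 1)
  have hτ2 : τ ^ 2 = 2 * lam - 1 := Real.sq_sqrt (by linarith)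
  have hκ2 : κ ^ 2 = 2 * lam + 1 := Real.sq_sqrt (by linarith)
  have hτ : 1 / 2 ≤ τ := Real.le_sqrt_of_sq_le (by linarith)
  have hκ : 1 ≤ κ := Real.one_le_sqrt.2 (by linarith)
  have hVs := contDiff_Q_pow_four hω.le
  obtain ⟨p, p', q, q', hp, hq, hp', hq', hpb, hqb⟩ := exists_perturbed_pair hτ hκ
    hVs.continuous (fun s => by positivity) (Q_pow_four_le hω.le) hω.le hω'.le
  let h₁ : ℝ → ℝ := fun y => (p y + q y + (p (-y) + q (-y))) / 4
  let h₂ : ℝ → ℝ := fun y => (p y - q y + (p (-y) - q (-y))) / 4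
  let g₁ : ℝ → ℝ := fun y => (p' y + q' y + (-p' (-y) + -q' (-y))) / 4
  let g₂ : ℝ → ℝ := fun y => (p' y - q' y + (-p' (-y) - -q' (-y))) / 4
  have hd₁ : ∀ y, HasDerivAt h₁ (g₁ y) y := fun y =>
    (((hp y).add (hq y)).add ((hasDerivAt_comp_neg (hp (-y))).add
      (hasDerivAt_comp_neg (hq (-y))))).div_const 4
  have hd₂ : ∀ y, HasDerivAt h₂ (g₂ y) y := fun y =>
    (((hp y).sub (hq y)).add ((hasDerivAt_comp_neg (hp (-y))).sub
      (hasDerivAt_comp_neg (hq (-y))))).div_const 4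
  have hdd₁ : ∀ y, HasDerivAt g₁ ((1 + ω / 3 * Q ω y ^ 4) * h₁ y + -(2 * lam) * h₂ y) y := by
    intro y
    refine ((((hp' y).add (hq' y)).add ((hasDerivAt_comp_neg (hp' (-y))).neg.add
      (hasDerivAt_comp_neg (hq' (-y))).neg)).div_const 4).congr_deriv ?_
    simp only [h₁, h₂, Q_neg, hτ2, hκ2]
    ring
  have hdd₂ : ∀ y, HasDerivAt g₂ (-(2 * lam) * h₁ y + (1 - ω * Q ω y ^ 4) * h₂ y) y := by
    intro y
    refine ((((hp' y).sub (hq' y)).add ((hasDerivAt_comp_neg (hp' (-y))).neg.sub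
      (hasDerivAt_comp_neg (hq' (-y))).neg)).div_const 4).congr_deriv ?_
    simp only [h₁, h₂, Q_neg, hτ2, hκ2]
    ring
  have hb : ∀ y, |h₁ y + cos (τ * y)| ≤ 128 * ω ∧ |h₂ y + cos (τ * y)| ≤ 128 * ω := by
    intro y
    have e1 := hpb y
    have e2 := hpb (-y)
    have e3 := hqb y
    have e4 := hqb (-y)
    rw [mul_neg, cos_neg] at e2
    simp only [h₁, h₂, abs_le] at *
    refine ⟨⟨?_, ?_⟩, ?_, ?_⟩ <;> linarith
  have hbdd : ∀ {h : ℝ → ℝ}, (∀ y, |h y + cos (τ * y)| ≤ 128 * ω) → ∃ M, ∀ y, |h y| ≤ M := by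
    intro h hh
    refine ⟨128 * ω + 1, fun y => ?_⟩
    have e1 := hh y
    have e2 := abs_cos_le_one (τ * y)
    rw [abs_le] at *
    constructor <;> linarith [e1.1, e1.2, e2.1, e2.2]
  obtain ⟨hs₁, hs₂⟩ := contDiff_of_linear_system
    (contDiff_const.add (contDiff_const.mul hVs)) contDiff_const contDiff_const
    (contDiff_const.sub (contDiff_const.mul hVs)) hd₁ hdd₁ hd₂ hdd₂
  have hderiv₁ : deriv h₁ = g₁ := funext fun y => (hd₁ y).deriv
  have hderiv₂ : deriv h₂ = g₂ := funext fun y => (hd₂ y).deriv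
  refine ⟨h₁, h₂, hs₁, hs₂, fun y => ?_, fun y => ?_, hbdd fun y => (hb y).1,
    hbdd fun y => (hb y).2, fun y => ?_, fun y => ?_, fun y => (hb y).1, fun y => (hb y).2⟩
  · simp only [h₁, neg_neg]
    ring
  · simp only [h₂, neg_neg]
    ring
  · simp only [Mp]
    rw [hderiv₁, (hdd₁ y).deriv]
    ring
  · simp only [Mm]
    rw [hderiv₂, (hdd₂ y).deriv]
    ring
end

section
/- For every integer k ≥ 1, setting p_k = ∫_ℝ Q₀(y)^k·cos(y) dy and q_k = ∫_ℝ Q₀(y)^k·ln(Q₀(y)/√8)·cos(y) dy, one has q_{k+2} = (2(k² + 1)/(k(k+1)))·q_k + (2(k² − 2k − 1)/(k²(k+1)²))·p_k. -/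
open Real

/-- `Q₀(y) = √2 / cosh y`. -/
noncomputable def Q0 (y : ℝ) : ℝ := Real.sqrt 2 / Real.cosh y

open MeasureTheory

lemma Q0_pos (y : ℝ) : 0 < Q0 y := div_pos (by positivity) (cosh_pos y)

lemma Q0_le (y : ℝ) : Q0 y ≤ √2 :=
  div_le_self (sqrt_nonneg 2) (one_le_cosh y)

lemma Q0_sq (y : ℝ) : Q0 y ^ 2 = 2 * (1 - tanh y ^ 2) := by
  have hc := (cosh_pos y).ne'
  rw [Q0, tanh_eq_sinh_div_cosh, div_pow, sq_sqrt zero_le_two]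
  field_simp
  linarith [cosh_sq y]

lemma Q0_div_sqrt_eight (y : ℝ) : Q0 y / √8 = (2 * cosh y)⁻¹ := by
  have hc := (cosh_pos y).ne'
  have h : √8 = 2 * √2 := by
    rw [show (8 : ℝ) = 2 ^ 2 * 2 by norm_num, sqrt_mul (by norm_num), sqrt_sq zero_le_two]
  rw [Q0, h]
  field_simp

lemma hasDerivAt_tanh_Q0 (y : ℝ) : HasDerivAt tanh (Q0 y ^ 2 / 2) y := by
  have hc := (cosh_pos y).ne'
  have h := (hasDerivAt_sinh y).div (hasDerivAt_cosh y) hc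
  have e : tanh = sinh / cosh := funext tanh_eq_sinh_div_cosh
  rw [e]
  refine h.congr_deriv ?_
  rw [Q0_sq, tanh_eq_sinh_div_cosh]
  field_simp

lemma hasDerivAt_Q0 (y : ℝ) : HasDerivAt Q0 (-(tanh y * Q0 y)) y := by
  have hc := (cosh_pos y).ne'
  have h := (hasDerivAt_const y (√2)).div (hasDerivAt_cosh y) hc
  refine h.congr_deriv ?_
  rw [Q0, tanh_eq_sinh_div_cosh]
  field_simp
  ring

lemma hasDerivAt_log_Q0 (y : ℝ) :
    HasDerivAt (fun y ↦ log (Q0 y / √8)) (-tanh y) y := by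
  have hQ := (Q0_pos y).ne'
  have h8 : √(8 : ℝ) ≠ 0 := by positivity
  have h := ((hasDerivAt_Q0 y).div_const (√8)).log (div_ne_zero hQ h8)
  convert h using 1
  field_simp

lemma continuous_Q0 : Continuous Q0 :=
  continuous_iff_continuousAt.2 fun y ↦ (hasDerivAt_Q0 y).continuousAt

lemma continuous_log_Q0 : Continuous fun y ↦ log (Q0 y / √8) :=
  continuous_iff_continuousAt.2 fun y ↦ (hasDerivAt_log_Q0 y).continuousAt

lemma continuous_real_tanh : Continuous tanh :=
  continuous_iff_continuousAt.2 fun y ↦ (hasDerivAt_tanh_Q0 y).continuousAt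

lemma integrable_exp_neg_half_abs : Integrable fun y : ℝ ↦ exp (-(|y| / 2)) := by
  rw [← integrableOn_univ, ← Set.Iic_union_Ioi (a := (0 : ℝ))]
  refine IntegrableOn.union ?_ ?_
  · refine (integrableOn_exp_mul_Iic (a := 1 / 2) (by norm_num) 0).congr_fun (fun y hy ↦ ?_)
      measurableSet_Iic
    simp only [abs_of_nonpos (Set.mem_Iic.1 hy)]
    ring_nf
  · refine (integrableOn_exp_mul_Ioi (a := -1 / 2) (by norm_num) 0).congr_fun (fun y hy ↦ ?_)
      measurableSet_Ioi
    simp only [abs_of_pos (Set.mem_Ioi.1 hy)]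
    ring_nf

lemma exp_abs_le_two_mul_cosh (y : ℝ) : exp |y| ≤ 2 * cosh y := by
  rw [← cosh_abs, cosh_eq]
  linarith [exp_pos (-|y|)]

lemma Q0_le_exp (y : ℝ) : Q0 y ≤ √8 * exp (-(|y| / 2)) := by
  have h8 : (0 : ℝ) < √8 := by positivity
  rw [← div_le_iff₀' h8, Q0_div_sqrt_eight, exp_neg]
  refine inv_anti₀ (exp_pos _) ((exp_le_exp.2 ?_).trans (exp_abs_le_two_mul_cosh y))
  linarith [abs_nonneg y]

lemma abs_Q0_mul_log_le (y : ℝ) :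
    |Q0 y * log (Q0 y / √8)| ≤ 2 * √8 * exp (-(|y| / 2)) := by
  have h8 : (0 : ℝ) < √8 := by positivity
  set E := 2 * cosh y with hE
  have hexp := exp_abs_le_two_mul_cosh y
  have hE1 : 1 ≤ E := by linarith [one_le_cosh y]
  have hE0 : 0 < E := by linarith
  set s := √E with hs
  have hs0 : 0 < s := sqrt_pos.2 hE0
  have hss : s ^ 2 = E := sq_sqrt hE0.le
  have hes : exp (|y| / 2) ≤ s := by
    refine le_sqrt_of_sq_le ?_
    rw [← exp_nat_mul]
    convert hexp using 2
    push_cast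
    ring
  have hlog : log E ≤ 2 * s := by
    rw [← hss, log_pow]
    push_cast
    linarith [log_le_sub_one_of_pos hs0]
  have hQ : Q0 y = √8 * E⁻¹ := by
    rw [← Q0_div_sqrt_eight]
    field_simp
  rw [abs_mul, abs_of_pos (Q0_pos y), Q0_div_sqrt_eight, log_inv, abs_neg,
    abs_of_nonneg (log_nonneg hE1), hQ]
  calc √8 * E⁻¹ * log E ≤ √8 * E⁻¹ * (2 * s) := by gcongr
    _ = 2 * √8 * s⁻¹ := by
      rw [← hss]
      field_simp
    _ ≤ 2 * √8 * exp (-(|y| / 2)) := by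
      rw [exp_neg]
      gcongr

lemma integrable_Q0 : Integrable Q0 :=
  (integrable_exp_neg_half_abs.const_mul (√8)).mono' continuous_Q0.aestronglyMeasurable
    (.of_forall fun y ↦ by simpa [abs_of_pos (Q0_pos y)] using Q0_le_exp y)

lemma integrable_Q0_mul_log : Integrable fun y ↦ Q0 y * log (Q0 y / √8) :=
  (integrable_exp_neg_half_abs.const_mul (2 * √8)).mono'
    (continuous_Q0.mul continuous_log_Q0).aestronglyMeasurable (.of_forall abs_Q0_mul_log_le)

lemma norm_Q0_pow_mul_le {h : ℝ → ℝ} {c : ℝ} (hc : ∀ y, |h y| ≤ c) (n : ℕ) (y : ℝ) :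
    ‖Q0 y ^ n * h y‖ ≤ √2 ^ n * c := by
  rw [norm_mul, norm_pow, norm_eq_abs, norm_eq_abs, abs_of_pos (Q0_pos y)]
  gcongr
  · exact (Q0_pos y).le
  · exact Q0_le y
  · exact hc y

lemma integrable_Q0_pow_mul {h : ℝ → ℝ} {c : ℝ} (hcont : Continuous h) (hc : ∀ y, |h y| ≤ c)
    {k : ℕ} (hk : 1 ≤ k) : Integrable fun y ↦ Q0 y ^ k * h y := by
  obtain ⟨n, rfl⟩ := Nat.exists_eq_add_of_le' hk
  refine (integrable_Q0.bdd_mul ((continuous_Q0.pow n).mul hcont).aestronglyMeasurable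
    (.of_forall (norm_Q0_pow_mul_le hc n))).congr (.of_forall fun y ↦ ?_)
  simp only [Pi.mul_apply, Pi.pow_apply]
  ring

lemma integrable_Q0_pow_mul_log_mul {h : ℝ → ℝ} {c : ℝ} (hcont : Continuous h)
    (hc : ∀ y, |h y| ≤ c) {k : ℕ} (hk : 1 ≤ k) :
    Integrable fun y ↦ Q0 y ^ k * log (Q0 y / √8) * h y := by
  obtain ⟨n, rfl⟩ := Nat.exists_eq_add_of_le' hk
  refine (integrable_Q0_mul_log.bdd_mul ((continuous_Q0.pow n).mul hcont).aestronglyMeasurable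
    (.of_forall (norm_Q0_pow_mul_le hc n))).congr (.of_forall fun y ↦ ?_)
  simp only [Pi.mul_apply, Pi.pow_apply]
  ring

lemma abs_tanh_mul_cos_le (y : ℝ) : |tanh y * cos y| ≤ 1 := by
  rw [abs_mul]
  exact mul_le_one₀ (abs_tanh_lt_one y).le (abs_nonneg _) (abs_cos_le_one y)

lemma hasDerivAt_Q0_pow {k : ℕ} (hk : 1 ≤ k) (y : ℝ) :
    HasDerivAt (fun y ↦ Q0 y ^ k) (-(k * tanh y * Q0 y ^ k)) y := by
  obtain ⟨n, rfl⟩ := Nat.exists_eq_add_of_le' hk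
  refine ((hasDerivAt_Q0 y).fun_pow (n + 1)).congr_deriv ?_
  simp only [Nat.add_sub_cancel]
  ring

lemma integral_Q0_pow_add_two {k : ℕ} (hk : 1 ≤ k) :
    (k : ℝ) * (k + 1) / 2 * ∫ y, Q0 y ^ (k + 2) * cos y
      = ((k : ℝ) ^ 2 + 1) * ∫ y, Q0 y ^ k * cos y := by
  have hp {m : ℕ} (hm : 1 ≤ m) := integrable_Q0_pow_mul continuous_cos abs_cos_le_one hm
  have hF' := ((hp hk).const_mul ((k : ℝ) ^ 2 + 1)).sub
    ((hp (by omega : 1 ≤ k + 2)).const_mul ((k : ℝ) * (k + 1) / 2))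
  have hF := (integrable_Q0_pow_mul continuous_sin abs_sin_le_one hk).sub
    ((integrable_Q0_pow_mul (continuous_real_tanh.mul continuous_cos) abs_tanh_mul_cos_le hk).const_mul
      (k : ℝ))
  have h0 := integral_eq_zero_of_hasDerivAt_of_integrable (fun y ↦ ?_) hF' hF
  · simp only [Pi.sub_def] at h0
    rw [integral_sub ((hp hk).const_mul _) ((hp (by omega)).const_mul _),
      integral_const_mul, integral_const_mul] at h0
    linarith
  · have hP := hasDerivAt_Q0_pow hk y
    refine ((hP.mul (hasDerivAt_sin y)).sub ((hP.mul
      ((hasDerivAt_tanh_Q0 y).mul (hasDerivAt_cos y))).const_mul (k : ℝ))).congr_deriv ?_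
    simp only [Pi.mul_apply, Pi.sub_apply, pow_add, Q0_sq]
    ring

lemma integral_Q0_pow_add_two_mul_log {k : ℕ} (hk : 1 ≤ k) :
    (k : ℝ) * (k + 1) / 2 * ∫ y, Q0 y ^ (k + 2) * log (Q0 y / √8) * cos y
      = ((k : ℝ) ^ 2 + 1) * (∫ y, Q0 y ^ k * log (Q0 y / √8) * cos y)
        + (2 * k * (∫ y, Q0 y ^ k * cos y)
          - (k + 1 / 2) * ∫ y, Q0 y ^ (k + 2) * cos y) := by
  have hk2 : 1 ≤ k + 2 := by omega
  have hp {m : ℕ} (hm : 1 ≤ m) := integrable_Q0_pow_mul continuous_cos abs_cos_le_one hm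
  have hq {m : ℕ} (hm : 1 ≤ m) := integrable_Q0_pow_mul_log_mul continuous_cos abs_cos_le_one hm
  have htc := continuous_real_tanh.mul continuous_cos
  have hI₁ := ((hq hk).const_mul ((k : ℝ) ^ 2 + 1)).sub
    ((hq hk2).const_mul ((k : ℝ) * (k + 1) / 2))
  have hI₂ := ((hp hk).const_mul (2 * k : ℝ)).sub ((hp hk2).const_mul (k + 1 / 2 : ℝ))
  have hF := ((integrable_Q0_pow_mul_log_mul continuous_sin abs_sin_le_one hk).sub
    ((integrable_Q0_pow_mul_log_mul htc abs_tanh_mul_cos_le hk).const_mul (k : ℝ))).sub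
    (integrable_Q0_pow_mul htc abs_tanh_mul_cos_le hk)
  have h0 := integral_eq_zero_of_hasDerivAt_of_integrable (fun y ↦ ?_) (hI₁.add hI₂) hF
  · rw [integral_add' hI₁ hI₂, integral_sub' ((hq hk).const_mul _) ((hq hk2).const_mul _),
      integral_sub' ((hp hk).const_mul _) ((hp hk2).const_mul _), integral_const_mul,
      integral_const_mul, integral_const_mul, integral_const_mul] at h0
    linarith
  · have hP := hasDerivAt_Q0_pow hk y
    have hL := hP.mul (hasDerivAt_log_Q0 y)
    have hT := (hasDerivAt_tanh_Q0 y).mul (hasDerivAt_cos y)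
    refine (((hL.mul (hasDerivAt_sin y)).sub ((hL.mul hT).const_mul (k : ℝ))).sub
      (hP.mul hT)).congr_deriv ?_
    simp only [Pi.mul_apply, Pi.sub_apply, Pi.add_apply, pow_add, Q0_sq]
    ring

/-- The recurrence `q_{k+2} = (2(k²+1)/(k(k+1))) q_k + (2(k²-2k-1)/(k²(k+1)²)) p_k`
for `p_k = ∫ Q₀^k cos` and `q_k = ∫ Q₀^k ln(Q₀/√8) cos`. -/
theorem q_recurrence (k : ℕ) (hk : 1 ≤ k) :
    (∫ y : ℝ, (Q0 y) ^ (k + 2) * Real.log (Q0 y / Real.sqrt 8) * Real.cos y)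
      = (2 * ((k : ℝ) ^ 2 + 1) / ((k : ℝ) * ((k : ℝ) + 1)))
          * (∫ y : ℝ, (Q0 y) ^ k * Real.log (Q0 y / Real.sqrt 8) * Real.cos y)
        + (2 * ((k : ℝ) ^ 2 - 2 * (k : ℝ) - 1) / ((k : ℝ) ^ 2 * ((k : ℝ) + 1) ^ 2))
          * ∫ y : ℝ, (Q0 y) ^ k * Real.cos y := by
  have hk0 : (0 : ℝ) < k := by exact_mod_cast hk
  have hp := integral_Q0_pow_add_two hk
  have hq := integral_Q0_pow_add_two_mul_log hk
  rw [mul_comm, ← eq_div_iff (by positivity)] at hp hq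
  rw [hq, hp]
  field_simp
  ring
end
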